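/- Let A₁, …, A_N be n×n positive definite complex matrices, let ω = (w₁, …, w_N) be a positive probability vector, and let p, q satisfy 0 < p ≤ q ≤ 1. Then Q_p(ω; A₁, …, A_N) ⪯ Q_q(ω; A₁, …, A_N) in the near-order. -/

import Mathlib

open Matrix
open scoped ComplexOrder

/-- Real power of a matrix via functional calculus on the spectrum (junk value
if the matrix is not Hermitian). -/
noncomputable def mrpow {n : ℕ} (A : Matrix (Fin n) (Fin n) ℂ) (r : ℝ) :
    Matrix (Fin n) (Fin n) ℂ :=
  if hA : A.IsHermitian then
    (hA.eigenvectorUnitary : Matrix (Fin n) (Fin n) ℂ) *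
      diagonal (fun i => ((hA.eigenvalues i ^ r : ℝ) : ℂ)) *
      (star (hA.eigenvectorUnitary : Matrix (Fin n) (Fin n) ℂ))
  else A

/-- The metric geometric mean `A # B = A^{1/2} (A^{-1/2} B A^{-1/2})^{1/2} A^{1/2}`. -/
noncomputable def sharp {n : ℕ} (A B : Matrix (Fin n) (Fin n) ℂ) :
    Matrix (Fin n) (Fin n) ℂ :=
  mrpow A (1/2) * mrpow (mrpow A (-(1/2)) * B * mrpow A (-(1/2))) (1/2) * mrpow A (1/2)

/-- The Loewner order `A ≤ B`, i.e. `B - A` is positive semidefinite. -/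
def loewnerLE {n : ℕ} (A B : Matrix (Fin n) (Fin n) ℂ) : Prop := (B - A).PosSemidef

/-- The near-order `A ⪯ B`, i.e. `A⁻¹ # B ≥ I` in the Loewner order. -/
def nearLE {n : ℕ} (A B : Matrix (Fin n) (Fin n) ℂ) : Prop := loewnerLE 1 (sharp A⁻¹ B)

/-- The quasi-arithmetic mean `Q_p(ω; A₁, …, A_N) = (Σⱼ wⱼ Aⱼ^p)^{1/p}`. -/
noncomputable def quasiArith {n N : ℕ} (w : Fin N → ℝ) (p : ℝ)
    (A : Fin N → Matrix (Fin n) (Fin n) ℂ) : Matrix (Fin n) (Fin n) ℂ :=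
  mrpow (∑ j, w j • mrpow (A j) p) (1/p)

section abstractPart
variable {E : Type*} [CStarAlgebra E] [PartialOrder E] [StarOrderedRing E]

lemma aux_conj_le {a b c : E} (hc : 0 ≤ c) (h : a ≤ b) : c * a * c ≤ c * b * c :=
  (IsSelfAdjoint.of_nonneg hc).conjugate_le_conjugate h

lemma aux_cancel {a b c d : E} (hd : 0 ≤ d) (h1 : d * c = 1) (h2 : c * d = 1)
    (h : c * a * c ≤ c * b * c) : a ≤ b := by
  have := aux_conj_le hd h
  have e : ∀ z : E, d * (c * z * c) * d = z := fun z => by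
    rw [show d * (c * z * c) * d = (d * c) * z * (c * d) by noncomm_ring, h1, h2]; simp
  rwa [e, e] at this

lemma aux_sq {a b : E} (ha : 0 ≤ a) (hb : 0 ≤ b) (h : a * a ≤ b * b) : a ≤ b := by
  have := CFC.sqrt_le_sqrt _ _ h
  rwa [CFC.sqrt_mul_self a ha, CFC.sqrt_mul_self b hb] at this

/-- a positive square root with positive inverse -/
lemma aux_root {x : E} (hx : IsStrictlyPositive x) :
    ∃ h d : E, 0 ≤ h ∧ 0 ≤ d ∧ h * h = x ∧ d * h = 1 ∧ h * d = 1 := by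
  refine ⟨x ^ (1/2 : ℝ), x ^ (-(1/2) : ℝ), CFC.rpow_nonneg, CFC.rpow_nonneg, ?_,
    CFC.rpow_neg_mul_rpow _ hx, CFC.rpow_mul_rpow_neg _ hx⟩
  rw [← CFC.rpow_add hx.isUnit]
  norm_num
  exact CFC.rpow_one x hx.nonneg

lemma aux_conj_nonneg {a c : E} (hc : 0 ≤ c) (h : 0 ≤ a) : 0 ≤ c * a * c := by
  simpa using aux_conj_le hc h

lemma aux_exists {x y : E} (hx : IsStrictlyPositive x) (hy : 0 ≤ y) :
    ∃ m : E, 0 ≤ m ∧ m * x * m = y := by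
  obtain ⟨h, d, hh, hd, rfl, h1, h2⟩ := aux_root hx
  refine ⟨d * CFC.sqrt (h * y * h) * d, aux_conj_nonneg hd (CFC.sqrt_nonneg _), ?_⟩
  have e := CFC.sqrt_mul_sqrt_self (h * y * h) (aux_conj_nonneg hh hy)
  generalize CFC.sqrt (h * y * h) = s at *
  calc d * s * d * (h * h) * (d * s * d) = d * s * (d * h) * (h * d) * s * d := by noncomm_ring
    _ = d * (s * s) * d := by rw [h1, h2]; noncomm_ring
    _ = (d * h) * y * (h * d) := by rw [e]; noncomm_ring
    _ = y := by rw [h1, h2]; simp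

lemma aux_base {x y m : E} (hx : IsStrictlyPositive x) (hxy : x ≤ y) (hm : 0 ≤ m)
    (e : m * x * m = y) : 1 ≤ m := by
  obtain ⟨h, d, hh, hd, rfl, h1, h2⟩ := aux_root hx
  apply aux_cancel hd h1 h2
  apply aux_sq (by simpa using hx.nonneg) (aux_conj_nonneg hh hm)
  have := aux_conj_le hh hxy
  rw [← e] at this
  convert this using 1 <;> noncomm_ring

lemma aux_double {x y m m' : E} (hx : IsStrictlyPositive x) (hm : 1 ≤ m)
    (e : m * x * m = y) (hm' : 0 ≤ m') (e' : m' * (x * x) * m' = y * y) : 1 ≤ m' := by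
  obtain ⟨h, d, hh, hd, rfl, h1, h2⟩ := aux_root hx
  have hm0 : (0 : E) ≤ m := zero_le_one.trans hm
  apply aux_cancel hd h1 h2
  have hD : h * 1 * h ≤ h * m * h := aux_conj_le hh hm
  refine hD.trans ?_
  have hDpos : IsStrictlyPositive (h * m * h) := hx.of_le (by simpa using hD)
  have hG : 0 ≤ h * m' * h := aux_conj_nonneg hh hm'
  have k1 : h * m * h ≤ h * (m * m) * h := by
    apply aux_conj_le hh
    obtain ⟨r, r', hr, -, rfl, -, -⟩ := aux_root (isStrictlyPositive_one.of_le hm)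
    have := aux_conj_le hr hm
    convert this using 1 <;> noncomm_ring
  have k2 := aux_conj_le hDpos.nonneg k1
  have k3 := aux_conj_le hG hD
  obtain ⟨f, f', hf, hf', ef, f1, f2⟩ := aux_root hDpos
  have k4 : (h * m' * h) * (h * 1 * h) * (h * m' * h) =
      (h * m * h) * (h * (m * m) * h) * (h * m * h) := by
    calc (h * m' * h) * (h * 1 * h) * (h * m' * h)
        = h * (m' * ((h * h) * (h * h)) * m') * h := by noncomm_ring
      _ = _ := by rw [e', ← e]; noncomm_ring
  rw [k4] at k3
  have k5 := k2.trans k3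
  rw [← ef] at k5 ⊢
  generalize h * m' * h = G at *
  apply aux_cancel hf' f1 f2
  apply aux_sq (aux_conj_nonneg hf (ef ▸ hDpos.nonneg)) (aux_conj_nonneg hf hG)
  have := aux_conj_le hf k5
  convert this using 1 <;> noncomm_ring

lemma aux_iter {x y : E} (hx : IsStrictlyPositive x) (hxy : x ≤ y) (k : ℕ) :
    ∀ m : E, 0 ≤ m → m * x ^ (2 ^ k) * m = y ^ (2 ^ k) → 1 ≤ m := by
  have hy : IsStrictlyPositive y := hx.of_le hxy
  have hpow : ∀ {z : E} (j : ℕ), IsStrictlyPositive z → IsStrictlyPositive (z ^ j) := by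
    intro z j hz
    exact (hz.isUnit.pow j).isStrictlyPositive (CFC.rpow_natCast z j hz.nonneg ▸ CFC.rpow_nonneg)
  induction k with
  | zero => intro m hm e; exact aux_base hx hxy hm (by simpa using e)
  | succ k ih =>
    intro m' hm' e'
    obtain ⟨m, hm, e⟩ := aux_exists (hpow (2 ^ k) hx) (hpow (2 ^ k) hy).nonneg
    refine aux_double (hpow (2 ^ k) hx) (ih m hm e) e hm' ?_
    rw [← pow_add, ← pow_add, ← two_mul, ← pow_succ', e']

lemma aux_main {S T : E} (hS : IsStrictlyPositive S) (hST : S ≤ T) {r : ℝ} (hr : 1 ≤ r)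
    {m : E} (hm : 0 ≤ m) (e : m * S ^ r * m = T ^ r) : 1 ≤ m := by
  have hT := hS.of_le hST
  obtain ⟨k, hk⟩ := pow_unbounded_of_one_lt r (one_lt_two)
  have hk0 : (0 : ℝ) < 2 ^ k := by positivity
  have hb : r / 2 ^ k ∈ Set.Icc (0 : ℝ) 1 := ⟨by positivity, by rw [div_le_one hk0]; exact hk.le⟩
  have key : ∀ z : E, IsStrictlyPositive z → (z ^ (r / 2 ^ k)) ^ (2 ^ k : ℕ) = z ^ r := by
    intro z hz
    rw [← CFC.rpow_natCast _ _ CFC.rpow_nonneg, CFC.rpow_rpow _ _ _ (by positivity) hz]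
    congr 1
    push_cast
    field_simp
  refine aux_iter (x := S ^ (r / 2 ^ k)) (y := T ^ (r / 2 ^ k)) ?_
    (CFC.rpow_le_rpow hb hST) k m hm ?_
  · exact (hS.isUnit.cfcRpow _ hS.nonneg).isStrictlyPositive CFC.rpow_nonneg
  · rw [key S hS, key T hT, e]

end abstractPart

open scoped MatrixOrder Matrix.Norms.L2Operator

lemma mrpow_eq {n : ℕ} {A : Matrix (Fin n) (Fin n) ℂ} (hA : 0 ≤ A) (r : ℝ) :
    mrpow A r = A ^ r := by
  have h : A.IsHermitian := (Matrix.nonneg_iff_posSemidef.1 hA).1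
  rw [CFC.rpow_eq_cfc_real hA, h.cfc_eq, mrpow, dif_pos h, IsHermitian.cfc,
    Unitary.conjStarAlgAut_apply]
  rfl

lemma sp_rpow {n : ℕ} {A : Matrix (Fin n) (Fin n) ℂ} (hA : IsStrictlyPositive A) (r : ℝ) :
    IsStrictlyPositive (A ^ r) :=
  (hA.isUnit.cfcRpow _ hA.nonneg).isStrictlyPositive CFC.rpow_nonneg

lemma sharp_spec {n : ℕ} {X Y : Matrix (Fin n) (Fin n) ℂ} (hX : IsStrictlyPositive X)
    (hY : 0 ≤ Y) : 0 ≤ sharp X⁻¹ Y ∧ sharp X⁻¹ Y * X * sharp X⁻¹ Y = Y := by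
  have hXi : IsStrictlyPositive X⁻¹ := hX.posDef.inv.isStrictlyPositive
  have hn := hXi.nonneg
  have hd : (0 : Matrix (Fin n) (Fin n) ℂ) ≤ X⁻¹ ^ (1/2 : ℝ) := CFC.rpow_nonneg
  have hh : (0 : Matrix (Fin n) (Fin n) ℂ) ≤ X⁻¹ ^ (-(1/2) : ℝ) := CFC.rpow_nonneg
  have hc := aux_conj_nonneg hh hY
  rw [sharp, mrpow_eq hn, mrpow_eq hn, mrpow_eq hc]
  refine ⟨aux_conj_nonneg hd CFC.rpow_nonneg, ?_⟩
  have h1 : X⁻¹ ^ (1/2 : ℝ) * X⁻¹ ^ (-(1/2) : ℝ) = 1 := CFC.rpow_mul_rpow_neg _ hXi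
  have h2 : X⁻¹ ^ (-(1/2) : ℝ) * X⁻¹ ^ (1/2 : ℝ) = 1 := CFC.rpow_neg_mul_rpow _ hXi
  have h3 : X⁻¹ ^ (1/2 : ℝ) * X⁻¹ ^ (1/2 : ℝ) = X⁻¹ := by
    rw [← CFC.rpow_add hXi.isUnit]; norm_num; exact CFC.rpow_one _ hn
  have h4 : X⁻¹ * X = 1 := Matrix.nonsing_inv_mul X ((Matrix.isUnit_iff_isUnit_det X).1 hX.isUnit)
  have e : ((X⁻¹ ^ (-(1/2) : ℝ) * Y * X⁻¹ ^ (-(1/2) : ℝ)) ^ (1/2 : ℝ)) *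
      ((X⁻¹ ^ (-(1/2) : ℝ) * Y * X⁻¹ ^ (-(1/2) : ℝ)) ^ (1/2 : ℝ)) =
      X⁻¹ ^ (-(1/2) : ℝ) * Y * X⁻¹ ^ (-(1/2) : ℝ) := by
    rw [← pow_two, ← CFC.rpow_natCast _ _ CFC.rpow_nonneg,
      CFC.rpow_rpow_of_exponent_nonneg _ _ _ (by norm_num) (by norm_num) hc]
    rw [show (1 / 2 : ℝ) * ((2 : ℕ) : ℝ) = 1 by norm_num]
    exact CFC.rpow_one _ hc
  generalize (X⁻¹ ^ (-(1/2) : ℝ) * Y * X⁻¹ ^ (-(1/2) : ℝ)) ^ (1/2 : ℝ) = s at *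
  generalize X⁻¹ ^ (1/2 : ℝ) = d at *
  generalize X⁻¹ ^ (-(1/2) : ℝ) = h at *
  have h5 : d * X * d = 1 := by
    calc d * X * d = (h * d) * (d * X) * (d * 1) := by rw [h2]; simp
      _ = h * (d * d) * X * d := by noncomm_ring
      _ = 1 := by rw [h3, mul_assoc h, h4, mul_one, h2]
  calc d * s * d * X * (d * s * d) = d * s * (d * X * d) * s * d := by noncomm_ring
    _ = d * (s * s) * d := by rw [h5]; noncomm_ring
    _ = (d * h) * Y * (h * d) := by rw [e]; noncomm_ring
    _ = Y := by rw [h1, h2]; simp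

lemma sum_sp {n N : ℕ} {B : Fin N → Matrix (Fin n) (Fin n) ℂ}
    (hB : ∀ j, IsStrictlyPositive (B j)) {w : Fin N → ℝ} (hw : ∀ j, 0 < w j)
    (hw1 : ∑ j, w j = 1) : IsStrictlyPositive (∑ j, w j • B j) := by
  have hne : (Finset.univ : Finset (Fin N)).Nonempty := by
    rw [Finset.nonempty_iff_ne_empty]
    intro h
    rw [h] at hw1
    simp at hw1
  apply Matrix.PosDef.isStrictlyPositive
  refine Matrix.posDef_sum hne fun j _ => ?_
  exact (hB j).posDef.smul (hw j)

theorem quasiArith_nearLE_quasiArith_pos {n N : ℕ}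
    (A : Fin N → Matrix (Fin n) (Fin n) ℂ) (hA : ∀ j, (A j).PosDef)
    (w : Fin N → ℝ) (hw : ∀ j, 0 < w j) (hw1 : ∑ j, w j = 1)
    (p q : ℝ) (hp0 : 0 < p) (hpq : p ≤ q) (hq1 : q ≤ 1) :
    nearLE (quasiArith w p A) (quasiArith w q A) := by
  have hq0 : 0 < q := hp0.trans_le hpq
  have hA' : ∀ j, IsStrictlyPositive (A j) := fun j => (hA j).isStrictlyPositive
  have hS := sum_sp (fun j => sp_rpow (hA' j) p) hw hw1
  have hT := sum_sp (fun j => sp_rpow (hA' j) q) hw hw1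
  have eQ : ∀ r : ℝ, quasiArith w r A = (∑ j, w j • A j ^ r) ^ (1 / r) := by
    intro r
    have h0 := (sum_sp (fun j => sp_rpow (hA' j) r) hw hw1).nonneg
    unfold quasiArith
    simp only [mrpow_eq (hA' _).nonneg]
    exact mrpow_eq h0 _
  rw [eQ, eQ]
  have hr : p / q ∈ Set.Icc (0 : ℝ) 1 := ⟨by positivity, by rw [div_le_one hq0]; exact hpq⟩
  have hJ := (CFC.concaveOn_rpow (A := Matrix (Fin n) (Fin n) ℂ) hr).le_map_sum
    (t := Finset.univ) (w := w) (p := fun j => A j ^ q) (fun j _ => (hw j).le) hw1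
    (fun j _ => Set.mem_Ici.2 CFC.rpow_nonneg)
  have hJ' : ∑ j, w j • A j ^ p ≤ (∑ j, w j • A j ^ q) ^ (p / q) := by
    convert hJ using 3 with j
    rw [CFC.rpow_rpow _ _ _ hq0.ne' (hA' j), mul_div_cancel₀ _ hq0.ne']
  have eY : ((∑ j, w j • A j ^ q) ^ (p / q)) ^ (1 / p) = (∑ j, w j • A j ^ q) ^ (1 / q) := by
    rw [CFC.rpow_rpow _ _ _ (by positivity) hT]
    congr 1
    field_simp
  obtain ⟨hm, e⟩ := sharp_spec (sp_rpow hS (1 / p)) (sp_rpow hT (1 / q)).nonneg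
  rw [nearLE, loewnerLE, ← Matrix.le_iff]
  refine aux_main hS hJ' (r := 1 / p) ?_ hm (e.trans eY.symm)
  rw [le_div_iff₀ hp0]
  linarith
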